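/- arXiv:2303.06316 — 2 statements merged into one kernel-verified Lean document; each statement's English description precedes it below -/
import Mathlib

section
/- For every integer N ≥ 1, every dimension d ≥ 1, and every x ∈ [0,1]^d, the functions φ_m form a partition of unity: ∑_{m ∈ {0,1,…,N}^d} φ_m(x) = 1. -/
open scoped BigOperators

/-- The piecewise-linear bump function `ψ`. -/
noncomputable def psi (x : ℝ) : ℝ :=
  if |x| ≤ 1 then 1 else if |x| ≤ 2 then 2 - |x| else 0

/-- The partition-of-unity factor `φ_m(x) = ∏_{k=1}^d ψ(3N(x_k − m_k/N))`. -/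
noncomputable def phi (d N : ℕ) (m : Fin d → ℕ) (x : Fin d → ℝ) : ℝ :=
  ∏ k, psi (3 * (N : ℝ) * (x k - (m k : ℝ) / (N : ℝ)))

theorem psi_sum_aux (n : ℕ) (t : ℝ) (ht : 0 ≤ t) :
    ∑ i ∈ Finset.range (n + 1), psi (3 * (t - (i : ℝ))) =
      if t ≤ n then 1 else psi (3 * (t - n)) := by
  induction n with
  | zero =>
    simp only [zero_add, Finset.sum_range_one, Nat.cast_zero]
    split_ifs with h
    · have : t = 0 := le_antisymm h ht
      subst this
      simp [psi]
    · rfl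
  | succ n ih =>
    rw [Finset.sum_range_succ, ih]
    push_cast
    by_cases h1 : t ≤ n
    · have h2 : t ≤ (n : ℝ) + 1 := by linarith
      have h3 : |3 * (t - ((n : ℝ) + 1))| = 3 * (((n : ℝ) + 1) - t) := by
        rw [abs_of_nonpos (by linarith)]; ring
      simp only [h1, h2, if_true, psi, h3]
      split_ifs <;> linarith
    · have h0 : |3 * (t - (n : ℝ))| = 3 * (t - n) := abs_of_nonneg (by linarith)
      by_cases h2 : t ≤ (n : ℝ) + 1
      · have h3 : |3 * (t - ((n : ℝ) + 1))| = 3 * (((n : ℝ) + 1) - t) := by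
          rw [abs_of_nonpos (by linarith)]; ring
        simp only [h1, h2, if_true, if_false, psi, h3, h0]
        split_ifs <;> linarith
      · simp only [h1, h2, if_false]
        have : psi (3 * (t - (n : ℝ))) = 0 := by
          simp only [psi, h0]
          split_ifs <;> linarith
        rw [this, zero_add]

/-- For every integer `N ≥ 1`, every dimension `d ≥ 1`, and every `x ∈ [0,1]^d`,
the functions `φ_m` form a partition of unity:
`∑_{m ∈ {0,1,…,N}^d} φ_m(x) = 1`. -/
theorem phi_partition_of_unity (N d : ℕ) (hN : 1 ≤ N) (hd : 1 ≤ d)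
    (x : Fin d → ℝ) (hx : ∀ k, x k ∈ Set.Icc (0 : ℝ) 1) :
    ∑ m : Fin d → Fin (N + 1), phi d N (fun k => (m k : ℕ)) x = 1 := by
  have hN' : (N : ℝ) ≠ 0 := by positivity
  have h1 : ∀ k, ∑ j : Fin (N + 1), psi (3 * (N : ℝ) * (x k - ((j : ℕ) : ℝ) / (N : ℝ))) = 1 := by
    intro k
    obtain ⟨ha, hb⟩ := hx k
    have hle : (N : ℝ) * x k ≤ N := mul_le_of_le_one_right (Nat.cast_nonneg N) hb
    have h := psi_sum_aux N (N * x k) (mul_nonneg (Nat.cast_nonneg N) ha)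
    rw [if_pos hle, Finset.sum_range] at h
    rw [← h]
    refine Finset.sum_congr rfl fun j _ => ?_
    congr 1
    field_simp
  unfold phi
  rw [← Fintype.prod_sum
    (fun k (j : Fin (N + 1)) => psi (3 * (N : ℝ) * (x k - ((j : ℕ) : ℝ) / (N : ℝ))))]
  exact Finset.prod_eq_one fun k _ => h1 k
end

section
/- A single quadratic neuron separates concentric hyperspheres in any dimension: for every integer d ≥ 1 and all radii 0 < r₁ < r₂, there exist quadratic-neuron parameters w₁, w₂, w₃ ∈ ℝ^d, b₁, b₂, b₃ ∈ ℝ such that the preactivation q satisfies q(x) < 0 for every x ∈ ℝ^d with ‖x‖₂ ≤ r₁ and q(x) > 0 for every x ∈ ℝ^d with ‖x‖₂ ≥ r₂. -/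
open scoped BigOperators

/-- A single quadratic neuron separates concentric hyperspheres in any dimension:
for every `d ≥ 1` and radii `0 < r₁ < r₂`, there are quadratic-neuron parameters
`w₁, w₂, w₃ ∈ ℝ^d`, `b₁, b₂, b₃ ∈ ℝ` whose preactivation
`q(x) = (w₁ᵀx + b₁)(w₂ᵀx + b₂) + w₃ᵀ(x ⊙ x) + b₃` is negative on the closed ball
of radius `r₁` and positive outside the open ball of radius `r₂`. -/
theorem quadratic_neuron_separates_hyperspheres (d : ℕ) (hd : 1 ≤ d)
    (r₁ r₂ : ℝ) (hr₁ : 0 < r₁) (hr : r₁ < r₂) :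
    ∃ (w₁ w₂ w₃ : Fin d → ℝ) (b₁ b₂ b₃ : ℝ),
      (∀ x : EuclideanSpace ℝ (Fin d), ‖x‖ ≤ r₁ →
        ((∑ i, w₁ i * x i) + b₁) * ((∑ i, w₂ i * x i) + b₂)
          + (∑ i, w₃ i * (x i * x i)) + b₃ < 0) ∧
      (∀ x : EuclideanSpace ℝ (Fin d), r₂ ≤ ‖x‖ →
        0 < ((∑ i, w₁ i * x i) + b₁) * ((∑ i, w₂ i * x i) + b₂)
          + (∑ i, w₃ i * (x i * x i)) + b₃) := by
  have key : ∀ x : EuclideanSpace ℝ (Fin d), ∑ i, x i * x i = ‖x‖ ^ 2 := by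
    intro x
    rw [EuclideanSpace.real_norm_sq_eq]
    exact Finset.sum_congr rfl fun i _ => (sq (x i)).symm
  refine ⟨0, 0, fun _ => 1, 0, 0, -(r₁ * r₂), fun x hx => ?_, fun x hx => ?_⟩
  · simp only [Pi.zero_apply, zero_mul, Finset.sum_const_zero, add_zero, zero_add, one_mul, key]
    nlinarith [norm_nonneg x]
  · simp only [Pi.zero_apply, zero_mul, Finset.sum_const_zero, add_zero, zero_add, one_mul, key]
    nlinarith [norm_nonneg x]
end
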